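/- Let λ⁺, λ⁻, μ⁺, μ⁻ ∈ ℝ with μ⁺(λ⁺ + 2μ⁺) ≠ 0 and μ⁻(λ⁻ + 2μ⁻) ≠ 0, let n = (n₁, n₂) ∈ ℝ² be a unit vector and t = (n₂, −n₁). Suppose G⁻ and G⁺ are 2×2 real matrices satisfying G⁺·t = G⁻·t and σ_{λ⁺,μ⁺}(G⁺)·n = σ_{λ⁻,μ⁻}(G⁻)·n. Then Vec(G⁺) = N(λ⁺,μ⁺,n)⁻¹·N(λ⁻,μ⁻,n)·Vec(G⁻) and Vec(G⁻) = N(λ⁻,μ⁻,n)⁻¹·N(λ⁺,μ⁺,n)·Vec(G⁺). -/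

import Mathlib

open Matrix

noncomputable section

/-- The 4×4 matrix `N(λ,μ,n)` associated with the elasticity interface jump conditions. -/
def Nmat (lam mu n1 n2 : ℝ) : Matrix (Fin 4) (Fin 4) ℝ :=
  !![(lam + 2*mu)*n1, mu*n2, mu*n2, lam*n1;
     lam*n2, mu*n1, mu*n1, (lam + 2*mu)*n2;
     -n2, 0, n1, 0;
     0, -n2, 0, n1]

/-- Column-stacking vectorization of a 2×2 matrix: `Vec(G) = (G₁₁, G₂₁, G₁₂, G₂₂)ᵀ`. -/
def Vec2 (G : Matrix (Fin 2) (Fin 2) ℝ) : Fin 4 → ℝ := ![G 0 0, G 1 0, G 0 1, G 1 1]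

/-- The stress matrix `σ_{λ,μ}(G) = λ·tr(G)·I₂ + μ·(G + Gᵀ)`. -/
def stress (lam mu : ℝ) (G : Matrix (Fin 2) (Fin 2) ℝ) : Matrix (Fin 2) (Fin 2) ℝ :=
  (lam * G.trace) • (1 : Matrix (Fin 2) (Fin 2) ℝ) + mu • (G + Gᵀ)

/-- The elasticity interface matrix has determinant `μ(λ+2μ)|n|⁴`. -/
lemma det_Nmat (lam mu n1 n2 : ℝ) :
    (Nmat lam mu n1 n2).det = mu * (lam + 2*mu) * (n1^2 + n2^2)^2 := by
  simp [Nmat, det_succ_row_zero, Fin.sum_univ_succ, Fin.succAbove]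
  ring

/-- `N(λ,μ,n)·Vec(G)` stacks the traction `σ(G)·n` on top of `-G·t`, where `t = (n₂, -n₁)`. -/
lemma Nmat_mulVec_Vec2 (lam mu n1 n2 : ℝ) (G : Matrix (Fin 2) (Fin 2) ℝ) :
    (Nmat lam mu n1 n2).mulVec (Vec2 G) =
      ![(stress lam mu G).mulVec ![n1, n2] 0, (stress lam mu G).mulVec ![n1, n2] 1,
        -G.mulVec ![n2, -n1] 0, -G.mulVec ![n2, -n1] 1] := by
  ext i
  fin_cases i <;>
    simp [Nmat, Vec2, stress, mulVec, dotProduct, Fin.sum_univ_four, trace] <;> ring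

lemma eq_inv_mul_mulVec {m R : Type*} [Fintype m] [DecidableEq m] [CommRing R]
    {A B : Matrix m m R} {v w : m → R} (hA : IsUnit A.det) (h : A.mulVec v = B.mulVec w) :
    v = (A⁻¹ * B).mulVec w := by
  rw [← mulVec_mulVec, ← h, mulVec_mulVec, nonsing_inv_mul A hA, one_mulVec]

/-- if the 2×2 matrices `G⁺`, `G⁻` satisfy the tangential continuity condition
`G⁺·t = G⁻·t` and the stress jump condition `σ⁺(G⁺)·n = σ⁻(G⁻)·n` at a unit normal `n`,
then `Vec(G⁺) = N⁺⁻¹N⁻·Vec(G⁻)` and `Vec(G⁻) = N⁻⁻¹N⁺·Vec(G⁺)`. -/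
theorem vec_jacobian_transfer (lp mp lm mm n1 n2 : ℝ)
    (hp : mp * (lp + 2*mp) ≠ 0) (hm : mm * (lm + 2*mm) ≠ 0)
    (hn : n1^2 + n2^2 = 1)
    (Gp Gm : Matrix (Fin 2) (Fin 2) ℝ)
    (hcont : Gp.mulVec ![n2, -n1] = Gm.mulVec ![n2, -n1])
    (hstress : (stress lp mp Gp).mulVec ![n1, n2] = (stress lm mm Gm).mulVec ![n1, n2]) :
    Vec2 Gp = ((Nmat lp mp n1 n2)⁻¹ * Nmat lm mm n1 n2).mulVec (Vec2 Gm) ∧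
    Vec2 Gm = ((Nmat lm mm n1 n2)⁻¹ * Nmat lp mp n1 n2).mulVec (Vec2 Gp) := by
  have h : (Nmat lp mp n1 n2).mulVec (Vec2 Gp) = (Nmat lm mm n1 n2).mulVec (Vec2 Gm) := by
    rw [Nmat_mulVec_Vec2, Nmat_mulVec_Vec2, hcont, hstress]
  have isUnit_det {lam mu : ℝ} (hlm : mu * (lam + 2*mu) ≠ 0) :
      IsUnit (Nmat lam mu n1 n2).det := by
    simpa only [det_Nmat, hn, one_pow, mul_one, isUnit_iff_ne_zero] using hlm
  exact ⟨eq_inv_mul_mulVec (isUnit_det hp) h, eq_inv_mul_mulVec (isUnit_det hm) h.symm⟩
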